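/- Let X be a compact metric space and T : X → X a continuous map. Let μ be a T-invariant Borel probability measure on X that is ergodic. Then there exists a continuous function f : X → ℝ such that μ is the unique f-maximizing invariant measure: for every T-invariant Borel probability measure ν on X one has ∫ f dν ≤ ∫ f dμ, and if ∫ f dν = ∫ f dμ then ν = μ. -/

import Mathlib

open MeasureTheory

open Filter Topology

namespace ContinuousMap

variable {X : Type*} [TopologicalSpace X] {T : X → X}

section Koopman

variable (hT : Continuous T)

/-- The Koopman operator `g ↦ g ∘ T` on continuous functions. -/
def koopman : C(X, ℝ) →ₗ[ℝ] C(X, ℝ) where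
  toFun g := g.comp ⟨T, hT⟩
  map_add' _ _ := rfl
  map_smul' _ _ := rfl

@[simp]
lemma koopman_apply (g : C(X, ℝ)) (x : X) : koopman hT g x = g (T x) := rfl

/-- The Birkhoff averages of a continuous function, as continuous functions. -/
noncomputable def ergodicAverage (n : ℕ) (g : C(X, ℝ)) : C(X, ℝ) :=
  birkhoffAverage ℝ (koopman hT) id n g

/-- The space of coboundaries `g ∘ T - g`. -/
noncomputable def coboundary : Submodule ℝ C(X, ℝ) :=
  LinearMap.range (koopman hT - LinearMap.id)

lemma iterate_koopman_sub_mem_coboundary (n : ℕ) (g : C(X, ℝ)) :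
    (koopman hT)^[n] g - g ∈ coboundary hT := by
  induction n with
  | zero => simp
  | succ n ih =>
    rw [Function.iterate_succ_apply', ← sub_add_sub_cancel _ ((koopman hT)^[n] g) g]
    exact add_mem ⟨_, rfl⟩ ih

lemma ergodicAverage_sub_mem_coboundary {n : ℕ} (hn : n ≠ 0) (g : C(X, ℝ)) :
    ergodicAverage hT n g - g ∈ coboundary hT := by
  have hg : ergodicAverage hT n g - g =
      (n : ℝ)⁻¹ • ∑ k ∈ Finset.range n, ((koopman hT)^[k] g - g) := by
    rw [Finset.sum_sub_distrib, smul_sub, Finset.sum_const, Finset.card_range,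
      ← Nat.cast_smul_eq_nsmul ℝ, inv_smul_smul₀ (Nat.cast_ne_zero.2 hn)]
    rfl
  rw [hg]
  exact Submodule.smul_mem _ _ (sum_mem fun k _ ↦ iterate_koopman_sub_mem_coboundary hT k g)

lemma ergodicAverage_add (n : ℕ) (g h : C(X, ℝ)) :
    ergodicAverage hT n (g + h) = ergodicAverage hT n g + ergodicAverage hT n h := by
  simp only [ergodicAverage, birkhoffAverage, birkhoffSum, id, iterate_map_add,
    Finset.sum_add_distrib, smul_add]

lemma ergodicAverage_apply (n : ℕ) (g : C(X, ℝ)) (x : X) :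
    ergodicAverage hT n g x = (n : ℝ)⁻¹ * ∑ k ∈ Finset.range n, g (T^[k] x) := by
  have h (k : ℕ) (x : X) : (koopman hT)^[k] g x = g (T^[k] x) := by
    induction k generalizing x with
    | zero => rfl
    | succ k ih =>
      rw [Function.iterate_succ_apply', koopman_apply, ih, ← Function.iterate_succ_apply]
  simp [ergodicAverage, birkhoffAverage, birkhoffSum, h]

lemma ergodicAverage_le {g : C(X, ℝ)} {c : ℝ} (hc : 0 ≤ c) (hg : ∀ x, g x ≤ c) (n : ℕ) (x : X) :
    ergodicAverage hT n g x ≤ c := by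
  rw [ergodicAverage_apply]
  rcases eq_or_ne n 0 with rfl | hn
  · simpa using hc
  · calc (n : ℝ)⁻¹ * ∑ k ∈ Finset.range n, g (T^[k] x)
        ≤ (n : ℝ)⁻¹ * ∑ _k ∈ Finset.range n, c := by gcongr; exact hg _
      _ = c := by simp [hn]

/-- `g` is bounded above by `c` after adding a coboundary. -/
def CohomologousLE (g : C(X, ℝ)) (c : ℝ) : Prop :=
  ∃ w ∈ coboundary hT, ∀ x, g x + w x ≤ c

variable [CompactSpace X]

lemma norm_iterate_koopman_le (n : ℕ) (g : C(X, ℝ)) : ‖(koopman hT)^[n] g‖ ≤ ‖g‖ := by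
  induction n with
  | zero => exact le_rfl
  | succ n ih =>
    rw [Function.iterate_succ_apply']
    exact ((ContinuousMap.norm_le _ (norm_nonneg _)).2 fun x ↦ norm_coe_le_norm _ (T x)).trans ih

lemma tendsto_ergodicAverage_of_mem_coboundary {w : C(X, ℝ)} (hw : w ∈ coboundary hT) :
    Tendsto (fun n ↦ ergodicAverage hT n w) atTop (𝓝 0) := by
  obtain ⟨g, rfl⟩ := hw
  have hb : Bornology.IsBounded (Set.range (id <| (koopman hT)^[·] g)) :=
    isBounded_iff_forall_norm_le.2
      ⟨‖g‖, Set.forall_mem_range.2 fun n ↦ norm_iterate_koopman_le hT n g⟩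
  refine (tendsto_birkhoffAverage_apply_sub_birkhoffAverage ℝ hb).congr fun n ↦ ?_
  simp only [ergodicAverage, birkhoffAverage, birkhoffSum, id, LinearMap.sub_apply,
    LinearMap.id_apply, iterate_map_sub, Finset.sum_sub_distrib, smul_sub]

variable {hT}

lemma CohomologousLE.eventually_ergodicAverage_le {g : C(X, ℝ)} {c : ℝ}
    (h : CohomologousLE hT g c) (hc : 0 ≤ c) {ε : ℝ} (hε : c < ε) :
    ∀ᶠ n in atTop, ∀ x, ergodicAverage hT n g x ≤ ε := by
  obtain ⟨w, hw, hgw⟩ := h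
  filter_upwards [(tendsto_ergodicAverage_of_mem_coboundary hT hw).eventually
    (Metric.ball_mem_nhds _ (sub_pos.2 hε))] with n hn x
  have h₁ := ergodicAverage_le hT (g := g + w) hc hgw n x
  have h₂ := (norm_coe_le_norm (ergodicAverage hT n w) x).trans_lt (mem_ball_zero_iff.1 hn)
  rw [ergodicAverage_add, ContinuousMap.add_apply] at h₁
  rw [Real.norm_eq_abs] at h₂
  linarith [(abs_lt.1 h₂).1]

end Koopman

section Integral

variable [CompactSpace X] [MeasurableSpace X] [BorelSpace X]

lemma integrable_of_isFiniteMeasure (ν : Measure X) [IsFiniteMeasure ν] (g : C(X, ℝ)) :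
    Integrable g ν :=
  g.continuous.integrable_of_hasCompactSupport (HasCompactSupport.of_compactSpace _)

/-- Integration against a probability measure, as a continuous functional on `C(X, ℝ)`. -/
noncomputable def integralCLM (ν : Measure X) [IsProbabilityMeasure ν] : C(X, ℝ) →L[ℝ] ℝ :=
  LinearMap.mkContinuous
    { toFun g := ∫ x, g x ∂ν
      map_add' g h :=
        integral_add (integrable_of_isFiniteMeasure ν g) (integrable_of_isFiniteMeasure ν h)
      map_smul' c g := integral_const_mul c g }
    1 fun g ↦ by
      simpa using norm_integral_le_of_norm_le_const (μ := ν) (ae_of_all _ g.norm_coe_le_norm)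

variable (ν : Measure X) [IsProbabilityMeasure ν]

lemma integralCLM_apply (g : C(X, ℝ)) : integralCLM ν g = ∫ x, g x ∂ν := rfl

@[simp]
lemma integralCLM_const (c : ℝ) : integralCLM ν (ContinuousMap.const X c) = c := by
  simp [integralCLM_apply]

lemma integralCLM_mono {g h : C(X, ℝ)} (hgh : ∀ x, g x ≤ h x) :
    integralCLM ν g ≤ integralCLM ν h :=
  integral_mono (integrable_of_isFiniteMeasure ν g) (integrable_of_isFiniteMeasure ν h) hgh

variable {ν} {hT : Continuous T}

lemma integralCLM_eq_zero_of_mem_coboundary (hν : MeasurePreserving T ν ν) {w : C(X, ℝ)}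
    (hw : w ∈ coboundary hT) : integralCLM ν w = 0 := by
  obtain ⟨g, rfl⟩ := hw
  have h : integralCLM ν (koopman hT g) = integralCLM ν g := by
    have := integral_map (μ := ν) (f := g) hν.measurable.aemeasurable
      (by rw [hν.map_eq]; exact (integrable_of_isFiniteMeasure ν g).aestronglyMeasurable)
    rw [hν.map_eq] at this
    exact this.symm
  simp [h]

lemma CohomologousLE.integralCLM_le (hν : MeasurePreserving T ν ν) {g : C(X, ℝ)} {c : ℝ}
    (h : CohomologousLE hT g c) : integralCLM ν g ≤ c := by
  obtain ⟨w, hw, hgw⟩ := h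
  have := integralCLM_mono ν (g := g + w) (h := ContinuousMap.const X c) hgw
  rwa [map_add, integralCLM_eq_zero_of_mem_coboundary hν hw, add_zero, integralCLM_const] at this

end Integral

end ContinuousMap

open ContinuousMap

section ErgodicMeasure

variable {X : Type*} [TopologicalSpace X] [CompactSpace X] [MeasurableSpace X] [BorelSpace X]
  {T : X → X} {μ : Measure X} [IsProbabilityMeasure μ]

lemma integral_abs_le_norm_toLp (g : C(X, ℝ)) :
    ∫ x, |g x| ∂μ ≤ ‖ContinuousMap.toLp (E := ℝ) 2 μ ℝ g‖ := by
  have hg := (integrable_of_isFiniteMeasure μ g).aestronglyMeasurable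
  have hL : ‖ContinuousMap.toLp (E := ℝ) 2 μ ℝ g‖ = (eLpNorm g 2 μ).toReal := by
    rw [Lp.norm_def, eLpNorm_congr_ae (coeFn_toLp (𝕜 := ℝ) (p := 2) μ g)]
  have hfin : eLpNorm g 2 μ ≠ ⊤ := by
    rw [← eLpNorm_congr_ae (coeFn_toLp (𝕜 := ℝ) (p := 2) μ g)]
    exact Lp.eLpNorm_ne_top _
  simp_rw [← Real.norm_eq_abs]
  rw [integral_norm_eq_lintegral_enorm hg, ← eLpNorm_one_eq_lintegral_enorm, hL]
  exact ENNReal.toReal_mono hfin (eLpNorm_le_eLpNorm_of_exponent_le one_le_two hg)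

/-- The `L¹` mean ergodic theorem for continuous functions of mean zero. -/
lemma Ergodic.tendsto_integral_abs_ergodicAverage (hT : Continuous T) (hμ : Ergodic T μ)
    {g : C(X, ℝ)} (hg : integralCLM μ g = 0) :
    Tendsto (fun n ↦ integralCLM μ |ergodicAverage hT n g|) atTop (𝓝 0) := by
  let U : Lp ℝ 2 μ →L[ℝ] Lp ℝ 2 μ :=
    (Lp.compMeasurePreservingₗᵢ ℝ T hμ.toMeasurePreserving).toContinuousLinearMap
  have hU (h : C(X, ℝ)) :
      ContinuousMap.toLp (E := ℝ) 2 μ ℝ (koopman hT h) = U (ContinuousMap.toLp 2 μ ℝ h) := by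
    apply Lp.ext
    refine (coeFn_toLp μ _).trans (.trans ?_ (Lp.coeFn_compMeasurePreserving _
      hμ.toMeasurePreserving).symm)
    exact (hμ.quasiMeasurePreserving.ae_eq_comp (coeFn_toLp μ h)).symm
  have hsemi (n : ℕ) : ContinuousMap.toLp (E := ℝ) 2 μ ℝ (ergodicAverage hT n g) =
      birkhoffAverage ℝ U id n (ContinuousMap.toLp 2 μ ℝ g) := by
    have hk (k : ℕ) : ContinuousMap.toLp (E := ℝ) 2 μ ℝ ((koopman hT)^[k] g) =
        U^[k] (ContinuousMap.toLp 2 μ ℝ g) :=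
      Function.Semiconj.iterate_right (f := ContinuousMap.toLp (E := ℝ) 2 μ ℝ) hU k g
    simp [ergodicAverage, birkhoffAverage, birkhoffSum, hk]
  have horth : ContinuousMap.toLp (E := ℝ) 2 μ ℝ g ∈
      (U.eqLocus (1 : Lp ℝ 2 μ →L[ℝ] Lp ℝ 2 μ))ᗮ := by
    refine (Submodule.mem_orthogonal _ _).2 fun z hz ↦ ?_
    have hz' : z ∘ T =ᵐ[μ] z := by
      have h := Lp.coeFn_compMeasurePreserving z hμ.toMeasurePreserving
      have hz : Lp.compMeasurePreserving T hμ.toMeasurePreserving z = z := hz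
      rw [hz] at h
      exact h.symm
    obtain ⟨c, hc⟩ := hμ.ae_eq_const_of_ae_eq_comp_ae (Lp.aestronglyMeasurable z) hz'
    rw [L2.inner_def]
    calc ∫ x, inner ℝ (z x) (ContinuousMap.toLp (E := ℝ) 2 μ ℝ g x) ∂μ = ∫ x, c * g x ∂μ := by
          refine integral_congr_ae ?_
          filter_upwards [hc, coeFn_toLp (𝕜 := ℝ) (p := 2) μ g] with x hx hgx
          rw [hx, hgx]
          simp [mul_comm]
      _ = 0 := by rw [integral_const_mul, ← integralCLM_apply, hg, mul_zero]
  have hlim := U.tendsto_birkhoffAverage_orthogonalProjection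
    (LinearIsometry.norm_toContinuousLinearMap_le _) (ContinuousMap.toLp (E := ℝ) 2 μ ℝ g)
  rw [Submodule.orthogonalProjectionOnto_eq_zero_iff.2 horth] at hlim
  have hlim' := hlim.norm
  rw [Submodule.coe_zero, norm_zero] at hlim'
  refine squeeze_zero (fun n ↦ integral_nonneg fun x ↦ abs_nonneg _) (fun n ↦ ?_) hlim'
  rw [← hsemi]
  exact integral_abs_le_norm_toLp _

/-- `g` has `μ`-mean zero and, modulo coboundaries, dominates `0` and `f` up to `ε`. -/
structure ApproxMajorant (hT : Continuous T) (μ : Measure X) [IsProbabilityMeasure μ]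
    (f : C(X, ℝ)) (ε : ℝ) (g : C(X, ℝ)) : Prop where
  integral_eq_zero : integralCLM μ g = 0
  neg_le : CohomologousLE hT (-g) ε
  sub_le : CohomologousLE hT (f - g) ε

lemma ApproxMajorant.exists_improvement {hT : Continuous T} (hμ : Ergodic T μ) {f g : C(X, ℝ)}
    (hf : integralCLM μ f = 0) {ε δ : ℝ} (hε : 0 < ε) (hδ : 0 < δ)
    (hg : ApproxMajorant hT μ f ε g) :
    ∃ g', ApproxMajorant hT μ f δ g' ∧ dist g g' ≤ 2 * ε + δ := by
  have hneg : integralCLM μ (-g) = 0 := by rw [map_neg, hg.integral_eq_zero, neg_zero]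
  have hsub : integralCLM μ (f - g) = 0 := by rw [map_sub, hf, hg.integral_eq_zero, sub_zero]
  have hlim := (hμ.tendsto_integral_abs_ergodicAverage hT hneg).add
    (hμ.tendsto_integral_abs_ergodicAverage hT hsub)
  rw [add_zero] at hlim
  obtain ⟨n, hn₁, hn₂, hn, hn0⟩ := ((hg.neg_le.eventually_ergodicAverage_le hε.le
    (lt_two_mul_self hε)).and ((hg.sub_le.eventually_ergodicAverage_le hε.le
    (lt_two_mul_self hε)).and ((hlim.eventually_lt_const hδ).and (eventually_ne_atTop 0)))).exists
  let a := ergodicAverage hT n (-g)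
  let b := ergodicAverage hT n (f - g)
  let r : C(X, ℝ) := 0 ⊔ (a ⊔ b)
  have hr0 (x : X) : 0 ≤ r x := le_sup_left
  have har (x : X) : a x ≤ r x := le_sup_left.trans (le_sup_right (a := (0 : ℝ)))
  have hbr (x : X) : b x ≤ r x := le_sup_right.trans (le_sup_right (a := (0 : ℝ)))
  have hrε (x : X) : r x ≤ 2 * ε := sup_le (by positivity) (sup_le (hn₁ x) (hn₂ x))
  let d := integralCLM μ r
  have hd0 : 0 ≤ d := integral_nonneg hr0
  have hdδ : d ≤ δ := by
    refine le_trans ?_ hn.le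
    rw [← map_add]
    refine integralCLM_mono μ fun x ↦ sup_le ?_ (sup_le ?_ ?_)
    · exact add_nonneg (abs_nonneg (a x)) (abs_nonneg (b x))
    · exact (le_abs_self (a x)).trans (le_add_of_nonneg_right (abs_nonneg (b x)))
    · exact (le_abs_self (b x)).trans (le_add_of_nonneg_left (abs_nonneg (a x)))
  refine ⟨g + r - ContinuousMap.const X d, ⟨?_, ?_, ?_⟩, ?_⟩
  · rw [map_sub, map_add, hg.integral_eq_zero, integralCLM_const, zero_add, sub_self]
  · refine ⟨_, ergodicAverage_sub_mem_coboundary hT hn0 (-g), fun x ↦ ?_⟩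
    have := har x
    simp only [ContinuousMap.neg_apply, ContinuousMap.sub_apply, ContinuousMap.add_apply,
      ContinuousMap.const_apply]
    change _ + (a x - _) ≤ _
    linarith
  · refine ⟨_, ergodicAverage_sub_mem_coboundary hT hn0 (f - g), fun x ↦ ?_⟩
    have := hbr x
    simp only [ContinuousMap.sub_apply, ContinuousMap.add_apply, ContinuousMap.const_apply]
    change _ + (b x - _) ≤ _
    linarith
  · refine (ContinuousMap.dist_le (by positivity)).2 fun x ↦ ?_
    have h₁ := hr0 x
    have h₂ := hrε x
    simp only [ContinuousMap.sub_apply, ContinuousMap.add_apply, ContinuousMap.const_apply]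
    rw [Real.dist_eq, abs_le]
    constructor <;> linarith

/-- For ergodic `μ`, a continuous function of `μ`-mean zero is dominated, on all invariant
measures, by one that is nonnegative on invariant measures and has `μ`-mean zero. -/
lemma Ergodic.exists_integral_majorant (hT : Continuous T) (hμ : Ergodic T μ) {f : C(X, ℝ)}
    (hf : integralCLM μ f = 0) :
    ∃ g : C(X, ℝ), integralCLM μ g = 0 ∧ ∀ (ν : Measure X) [IsProbabilityMeasure ν],
      MeasurePreserving T ν ν → 0 ≤ integralCLM ν g ∧ integralCLM ν f ≤ integralCLM ν g := by
  let C := ‖f‖ + 1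
  have hC : 0 < C := by positivity
  have hε (n : ℕ) : 0 < C / 2 ^ n := by positivity
  have h0 : ApproxMajorant hT μ f (C / 2 ^ 0) 0 := by
    refine ⟨map_zero _, ⟨0, zero_mem _, fun x ↦ ?_⟩, ⟨0, zero_mem _, fun x ↦ ?_⟩⟩
    · simpa using hC.le
    · have := (le_abs_self _).trans (f.norm_coe_le_norm x)
      simp only [sub_zero, ContinuousMap.zero_apply, add_zero, pow_zero, div_one, C]
      linarith
  choose improve himprove hdist using fun (n : ℕ) (g : {g // ApproxMajorant hT μ f (C / 2 ^ n) g}) ↦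
    g.2.exists_improvement hμ hf (hε n) (hε (n + 1))
  let G (n : ℕ) : {g // ApproxMajorant hT μ f (C / 2 ^ n) g} :=
    Nat.rec ⟨0, h0⟩ (fun n g ↦ ⟨improve n g, himprove n g⟩) n
  have hG (n : ℕ) : dist (G n).1 (G (n + 1)).1 ≤ 6 * C / 2 / 2 ^ n := by
    refine (hdist n (G n)).trans ?_
    rw [pow_succ, ← div_div]
    have := (hε n).le
    calc 2 * (C / 2 ^ n) + C / 2 ^ n / 2 ≤ 3 * (C / 2 ^ n) := by linarith
      _ = 6 * C / 2 / 2 ^ n := by ring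
  obtain ⟨g, hg⟩ := cauchySeq_tendsto_of_complete (cauchySeq_of_le_geometric_two hG)
  have hlim (ν : Measure X) [IsProbabilityMeasure ν] :
      Tendsto (fun n ↦ integralCLM ν (G n).1) atTop (𝓝 (integralCLM ν g)) :=
    ((integralCLM ν).continuous.tendsto g).comp hg
  have hε0 : Tendsto (fun n : ℕ ↦ C / 2 ^ n) atTop (𝓝 0) :=
    tendsto_const_nhds.div_atTop (tendsto_pow_atTop_atTop_of_one_lt one_lt_two)
  refine ⟨g, tendsto_nhds_unique (hlim μ) ?_, fun ν _ hν ↦ ⟨?_, ?_⟩⟩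
  · simp_rw [fun n ↦ (G n).2.integral_eq_zero]
    exact tendsto_const_nhds
  · have := le_of_tendsto_of_tendsto' (hlim ν).neg hε0 fun n ↦ by
      simpa only [map_neg] using (G n).2.neg_le.integralCLM_le hν
    linarith
  · have := le_of_tendsto_of_tendsto' ((hlim ν).const_sub (integralCLM ν f)) hε0 fun n ↦ by
      simpa only [map_sub] using (G n).2.sub_le.integralCLM_le hν
    linarith

end ErgodicMeasure

/-- **Ergodic measures are exposed (Jenkinson).** Let `T` be a continuous map of a compact
metric space `X` and let `μ` be an ergodic `T`-invariant Borel probability measure. Then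
there is a continuous `f : X → ℝ` such that `μ` is the unique `f`-maximizing invariant
measure: every `T`-invariant Borel probability measure `ν` satisfies `∫ f dν ≤ ∫ f dμ`,
with equality only if `ν = μ`. -/
theorem ergodic_measure_uniquely_maximizing
    {X : Type*} [MetricSpace X] [CompactSpace X]
    [MeasurableSpace X] [BorelSpace X]
    (T : X → X) (hT : Continuous T)
    (μ : Measure X) [IsProbabilityMeasure μ] (hμ : Ergodic T μ) :
    ∃ f : C(X, ℝ), ∀ ν : Measure X, IsProbabilityMeasure ν → Measure.map T ν = ν →
      (∫ x, f x ∂ν ≤ ∫ x, f x ∂μ) ∧ ((∫ x, f x ∂ν = ∫ x, f x ∂μ) → ν = μ) := by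
  let φ := TopologicalSpace.denseSeq C(X, ℝ)
  have hφ : DenseRange φ := TopologicalSpace.denseRange_denseSeq _
  choose h hμh hνh using fun n ↦ hμ.exists_integral_majorant hT
    (f := φ n - ContinuousMap.const X (integralCLM μ (φ n))) (by simp)
  let c (n : ℕ) : ℝ := (1 / 2) ^ n / (1 + ‖h n‖)
  have hc (n : ℕ) : 0 < c n := by positivity
  have hsum : Summable fun n ↦ c n • h n := by
    refine .of_norm_bounded summable_geometric_two fun n ↦ ?_
    rw [norm_smul, Real.norm_of_nonneg (hc n).le, div_mul_eq_mul_div]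
    exact div_le_of_le_mul₀ (by positivity) (by positivity) (by gcongr; linarith)
  have hasSum (ν : Measure X) [IsProbabilityMeasure ν] :
      HasSum (fun n ↦ c n * integralCLM ν (h n)) (integralCLM ν (∑' n, c n • h n)) := by
    simpa [Function.comp_def] using (integralCLM ν).hasSum hsum.hasSum
  have hμ0 : integralCLM μ (∑' n, c n • h n) = 0 := by
    refine (hasSum μ).unique ?_
    simp [hμh, hasSum_zero]
  refine ⟨-∑' n, c n • h n, fun ν hν hTν ↦ ?_⟩
  have hTν : MeasurePreserving T ν ν := ⟨hT.measurable, hTν⟩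
  have hnonneg (n : ℕ) : 0 ≤ c n * integralCLM ν (h n) :=
    mul_nonneg (hc n).le (hνh n ν hTν).1
  rw [← integralCLM_apply, ← integralCLM_apply, map_neg, map_neg, hμ0, neg_zero, neg_eq_zero,
    neg_nonpos]
  refine ⟨(hasSum ν).nonneg hnonneg, fun hν0 ↦ ?_⟩
  have hzero := (hasSum_zero_iff_of_nonneg hnonneg).1 (hν0 ▸ hasSum ν)
  have hle (g : C(X, ℝ)) : integralCLM ν g ≤ integralCLM μ g := by
    refine hφ.induction_on g (isClosed_le (integralCLM ν).continuous (integralCLM μ).continuous)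
      fun n ↦ ?_
    have h₁ := (hνh n ν hTν).2
    have h₂ := (mul_eq_zero.1 (congrFun hzero n)).resolve_left (hc n).ne'
    rw [map_sub, integralCLM_const, h₂] at h₁
    exact sub_nonpos.1 h₁
  refine ext_of_forall_integral_eq_of_IsFiniteMeasure fun g ↦ ?_
  have h₁ := hle g.toContinuousMap
  have h₂ := hle (-g.toContinuousMap)
  rw [map_neg, map_neg, neg_le_neg_iff] at h₂
  exact h₁.antisymm h₂
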